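/- Let C be a binary projective three-weight linear code of length n, dimension k and minimum distance d, with A_n(C) = 1. Then for every integer r with 2 ≤ r ≤ ⌊n/2⌋ − 1 such that A_{2r}(C^⊥) ≠ 0, the codewords of weight 2r in the dual code C^⊥ hold a 2-(n, 2r, λ_r^⊥) design, where λ_r^⊥ satisfies λ_r^⊥·n·(n − 1) = 2r·(2r − 1)·A_{2r}(C^⊥). -/

import Mathlib

/-- Hamming weight of a binary vector: the number of nonzero coordinates. -/
noncomputable def wt {ι : Type*} (c : ι → ZMod 2) : ℕ := Nat.card {i : ι // c i ≠ 0}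

/-- Number of codewords of Hamming weight `w` in a set of binary vectors. -/
noncomputable def weightCount {ι : Type*} (C : Set (ι → ZMod 2)) (w : ℕ) : ℕ :=
  Nat.card {c : ι → ZMod 2 // c ∈ C ∧ wt c = w}

/-- The dual code: all vectors orthogonal (standard inner product) to every codeword. -/
def dualCode {ι : Type*} (C : Set (ι → ZMod 2)) : Set (ι → ZMod 2) :=
  {x | ∀ c ∈ C, ∑ᶠ i, x i * c i = 0}

/-- A code is projective if the minimum distance of its dual is at least 3. -/
def IsProjective {ι : Type*} (C : Set (ι → ZMod 2)) : Prop :=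
  ∀ x ∈ dualCode C, x ≠ 0 → 3 ≤ wt x

/-- `d` is the minimum distance of `C`: the least Hamming weight of a nonzero codeword. -/
def IsMinDist {ι : Type*} (C : Set (ι → ZMod 2)) (d : ℕ) : Prop :=
  (∃ c ∈ C, c ≠ 0 ∧ wt c = d) ∧ ∀ c ∈ C, c ≠ 0 → d ≤ wt c

/-- The number of nonzero Hamming weights occurring among codewords of `C`. -/
noncomputable def numNonzeroWeights {ι : Type*} (C : Set (ι → ZMod 2)) : ℕ :=
  Nat.card {i : ℕ | 1 ≤ i ∧ weightCount C i ≠ 0}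

/-- The codewords of weight `w` in `C` hold a 2-design with index `lam`: every pair of
distinct coordinate positions lies in the support of exactly `lam` codewords of weight `w`. -/
def HoldsTwoDesign {ι : Type*} (C : Set (ι → ZMod 2)) (w lam : ℕ) : Prop :=
  ∀ p q : ι, p ≠ q →
    Nat.card {c : ι → ZMod 2 // c ∈ C ∧ wt c = w ∧ c p ≠ 0 ∧ c q ≠ 0} = lam

/-- The sign character of `ZMod 2`. -/
noncomputable def sgn (a : ZMod 2) : ℚ := if a = 0 then 1 else -1

theorem zmod2_cases (a : ZMod 2) : a = 0 ∨ a = 1 := by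
  revert a; decide

theorem sgn_zero : sgn 0 = 1 := by simp [sgn]

theorem sgn_one : sgn 1 = -1 := by simp [sgn]

theorem sgn_add (a b : ZMod 2) : sgn (a + b) = sgn a * sgn b := by
  have h : (1 : ZMod 2) + 1 = 0 := by decide
  rcases zmod2_cases a with rfl | rfl <;> rcases zmod2_cases b with rfl | rfl <;>
    simp [h, sgn_zero, sgn_one]

/-- Sum of the signs of the coordinates. -/
noncomputable def ssum {n : ℕ} (c : Fin n → ZMod 2) : ℚ := ∑ i, sgn (c i)

theorem wt_eq_card {n : ℕ} (c : Fin n → ZMod 2) :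
    wt c = (Finset.univ.filter (fun i => c i ≠ 0)).card := by
  unfold wt
  rw [Nat.card_eq_fintype_card, Fintype.card_subtype]

theorem ssum_eq {n : ℕ} (c : Fin n → ZMod 2) : ssum c = (n : ℚ) - 2 * (wt c : ℚ) := by
  have h : ∀ i, sgn (c i) = 1 - 2 * (if c i ≠ 0 then (1 : ℚ) else 0) := by
    intro i
    rcases zmod2_cases (c i) with h | h <;> simp [h, sgn_zero, sgn_one]
    norm_num
  unfold ssum
  simp_rw [h]
  rw [Finset.sum_sub_distrib, ← Finset.mul_sum, wt_eq_card, Finset.sum_boole]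
  simp

theorem ssum_add_single {n : ℕ} (c : Fin n → ZMod 2) (p : Fin n) :
    ssum (c + Pi.single p 1) = ssum c - 2 * sgn (c p) := by
  unfold ssum
  have h : ∀ i, sgn ((c + Pi.single p 1 : Fin n → ZMod 2) i) = sgn (c i) - if i = p then 2 * sgn (c p) else 0 := by
    intro i
    rw [Pi.add_apply, sgn_add]
    by_cases hi : i = p
    · subst hi; simp [sgn_one]; ring
    · simp [hi, sgn_zero]
  simp_rw [h]
  rw [Finset.sum_sub_distrib]
  simp

/-- The standard inner product. -/
noncomputable def ip {n : ℕ} (x c : Fin n → ZMod 2) : ZMod 2 := ∑ i, x i * c i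

theorem ip_add_right {n : ℕ} (x c d : Fin n → ZMod 2) : ip x (c + d) = ip x c + ip x d := by
  simp [ip, mul_add, Finset.sum_add_distrib]

theorem ip_add_left {n : ℕ} (x c d : Fin n → ZMod 2) : ip (c + d) x = ip c x + ip d x := by
  simp [ip, add_mul, Finset.sum_add_distrib]

theorem ip_comm {n : ℕ} (x c : Fin n → ZMod 2) : ip x c = ip c x := by
  simp [ip, mul_comm]

theorem ip_single {n : ℕ} (x : Fin n → ZMod 2) (p : Fin n) : ip (Pi.single p 1) x = x p := by
  simp [ip, Pi.single_apply]

theorem mem_dual {n : ℕ} (C : Set (Fin n → ZMod 2)) (x : Fin n → ZMod 2) :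
    x ∈ dualCode C ↔ ∀ c ∈ C, ip x c = 0 := by
  simp [dualCode, ip, finsum_eq_sum_of_fintype]

open Classical in
theorem orth_zero {n : ℕ} (C : Submodule (ZMod 2) (Fin n → ZMod 2)) (x : Fin n → ZMod 2)
    (hx : x ∉ dualCode (C : Set (Fin n → ZMod 2))) : ∑ c : C, sgn (ip x c) = 0 := by
  rw [mem_dual] at hx
  push Not at hx
  obtain ⟨c0, hc0, hne⟩ := hx
  have h1 : ip x c0 = 1 := (zmod2_cases _).resolve_left hne
  have h2 := Equiv.sum_comp (Equiv.addRight (⟨c0, hc0⟩ : C)) (fun c : C => sgn (ip x c))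
  simp only [Equiv.coe_addRight, Submodule.coe_add, ip_add_right, sgn_add, h1, sgn_one] at h2
  rw [← Finset.sum_mul] at h2
  linarith

open Classical in
theorem orth_card {n : ℕ} (C : Submodule (ZMod 2) (Fin n → ZMod 2)) (x : Fin n → ZMod 2)
    (hx : x ∈ dualCode (C : Set (Fin n → ZMod 2))) :
    ∑ c : C, sgn (ip x c) = Fintype.card C := by
  rw [mem_dual] at hx
  have : ∀ c : C, sgn (ip x c) = 1 := fun c => by rw [hx c c.2, sgn_zero]
  simp [this]

open Classical in
/-- Krawtchouk sum. -/
noncomputable def kraw {n : ℕ} (m : ℕ) (v : Fin n → ZMod 2) : ℚ :=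
  ∑ x : Fin n → ZMod 2, if wt x = m then sgn (ip x v) else 0

theorem wt_comp {n : ℕ} (c : Fin n → ZMod 2) (e : Equiv.Perm (Fin n)) : wt (c ∘ e) = wt c := by
  unfold wt
  exact Nat.card_congr (e.subtypeEquiv (fun i => by simp))

theorem exists_perm {n : ℕ} (v w : Fin n → ZMod 2) (h : wt v = wt w) :
    ∃ e : Equiv.Perm (Fin n), v = w ∘ e := by
  have h1 : Fintype.card {i // v i ≠ 0} = Fintype.card {i // w i ≠ 0} := by
    unfold wt at h
    rwa [Nat.card_eq_fintype_card, Nat.card_eq_fintype_card] at h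
  let e0 := Fintype.equivOfCardEq h1
  refine ⟨e0.extendSubtype, ?_⟩
  ext1 i
  by_cases hi : v i ≠ 0
  · have := e0.extendSubtype_mem i hi
    rw [Function.comp_apply, (zmod2_cases _).resolve_left hi, (zmod2_cases _).resolve_left this]
  · have := e0.extendSubtype_not_mem i hi
    push Not at hi this
    rw [Function.comp_apply, hi, this]

theorem kraw_congr {n : ℕ} (m : ℕ) (v w : Fin n → ZMod 2) (h : wt v = wt w) :
    kraw m v = kraw m w := by
  obtain ⟨e, rfl⟩ := exists_perm v w h
  unfold kraw
  rw [← Equiv.sum_comp (Equiv.arrowCongr e.symm (Equiv.refl (ZMod 2)))]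
  refine Finset.sum_congr rfl fun x _ => ?_
  have h1 : (Equiv.arrowCongr e.symm (Equiv.refl (ZMod 2))) x = x ∘ e := by
    ext1 i; simp [Equiv.arrowCongr]
  rw [h1, wt_comp]
  have h2 : ip (x ∘ e) (w ∘ e) = ip x w := by
    unfold ip
    exact Equiv.sum_comp e (fun i => x i * w i)
  rw [h2]

theorem kraw_factor (n m : ℕ) : ∃ φ : ℚ → ℚ, ∀ v : Fin n → ZMod 2, kraw m v = φ (ssum v) := by
  have h : Function.FactorsThrough (fun v : Fin n → ZMod 2 => kraw m v) ssum := by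
    intro v w hvw
    rw [ssum_eq, ssum_eq] at hvw
    apply kraw_congr
    have : (wt v : ℚ) = wt w := by linarith
    exact_mod_cast this
  refine ⟨Function.extend ssum (fun v : Fin n → ZMod 2 => kraw m v) 0, fun v => ?_⟩
  rw [h.extend_apply]

open Classical in
theorem poisson {n : ℕ} (C : Submodule (ZMod 2) (Fin n → ZMod 2)) (m : ℕ) (u : Fin n → ZMod 2) :
    (Fintype.card C : ℚ) * (∑ x : Fin n → ZMod 2,
      if x ∈ dualCode (C : Set (Fin n → ZMod 2)) ∧ wt x = m then sgn (ip x u) else 0)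
      = ∑ c : C, kraw m (c.1 + u) := by
  unfold kraw
  rw [Finset.sum_comm, Finset.mul_sum]
  refine Finset.sum_congr rfl fun x _ => ?_
  by_cases hm : wt x = m
  · simp only [hm, and_true, if_true, ip_add_right, sgn_add]
    rw [← Finset.sum_mul]
    by_cases hx : x ∈ dualCode (C : Set (Fin n → ZMod 2))
    · rw [orth_card C x hx]; simp [hx]
    · rw [orth_zero C x hx]; simp [hx]
  · simp [hm]

/-- The weights of the code. -/
theorem weights_structure {n : ℕ} (hn : 1 ≤ n) (C : Submodule (ZMod 2) (Fin n → ZMod 2))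
    (h3 : numNonzeroWeights (C : Set (Fin n → ZMod 2)) = 3)
    (hAn : weightCount (C : Set (Fin n → ZMod 2)) n = 1) :
    (1 : Fin n → ZMod 2) ∈ C ∧ ∃ s : ℚ, s ≠ 0 ∧ ∀ c ∈ C, c = 0 ∨ c = 1 ∨ ssum c = s ∨ ssum c = -s := by
  have hfull : ∀ c : Fin n → ZMod 2, wt c = n → c = 1 := by
    intro c hc
    rw [wt_eq_card] at hc
    have h2 : Finset.univ.filter (fun i => c i ≠ 0) = Finset.univ := by
      apply Finset.eq_univ_of_card; simpa using hc
    ext1 i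
    have : i ∈ Finset.univ.filter (fun i => c i ≠ 0) := by rw [h2]; simp
    exact (zmod2_cases _).resolve_left (by simpa using this)
  have hzero : ∀ c : Fin n → ZMod 2, wt c = 0 → c = 0 := by
    intro c hc
    rw [wt_eq_card, Finset.card_eq_zero, Finset.filter_eq_empty_iff] at hc
    ext1 i
    simpa using hc (Finset.mem_univ i)
  have hle : ∀ c : Fin n → ZMod 2, wt c ≤ n := by
    intro c
    rw [wt_eq_card]
    simpa using Finset.card_le_univ (Finset.univ.filter (fun i => c i ≠ 0))
  have hcount : ∀ i, weightCount (C : Set (Fin n → ZMod 2)) i ≠ 0 ↔ ∃ c ∈ C, wt c = i := by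
    intro i
    unfold weightCount
    rw [Nat.card_ne_zero]
    constructor
    · rintro ⟨⟨c, hc⟩, _⟩
      exact ⟨c, hc.1, hc.2⟩
    · rintro ⟨c, hc⟩
      exact ⟨⟨c, hc⟩, inferInstance⟩
  have hone : (1 : Fin n → ZMod 2) ∈ C := by
    obtain ⟨c, hc, hw⟩ := (hcount n).1 (by omega)
    rwa [← hfull c hw]
  have hcompl : ∀ c : Fin n → ZMod 2, wt (c + 1) + wt c = n := by
    intro c
    have h1 : ssum (c + 1) = - ssum c := by
      unfold ssum
      rw [← Finset.sum_neg_distrib]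
      refine Finset.sum_congr rfl fun i _ => ?_
      simp [sgn_add, sgn_one]
    rw [ssum_eq, ssum_eq] at h1
    have : ((wt (c + 1) : ℚ) + wt c) = n := by linarith
    exact_mod_cast this
  refine ⟨hone, ?_⟩
  unfold numNonzeroWeights at h3
  rw [Nat.card_coe_set_eq, Set.ncard_eq_three] at h3
  obtain ⟨x, y, z, hxy, hxz, hyz, hW⟩ := h3
  have hmem : ∀ i, (1 ≤ i ∧ ∃ c ∈ C, wt c = i) ↔ (i = x ∨ i = y ∨ i = z) := by
    intro i
    rw [← hcount]
    have := Set.ext_iff.1 hW i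
    simpa using this
  have hcl : ∀ i, (i = x ∨ i = y ∨ i = z) → 1 ≤ i ∧ i ≤ n ∧
      (i ≠ n → (n - i = x ∨ n - i = y ∨ n - i = z)) := by
    intro i hi
    obtain ⟨h1, c, hc, hw⟩ := (hmem i).2 hi
    have h2 := hcompl c
    refine ⟨h1, by have := hle c; omega, fun hne => (hmem _).1 ⟨?_, c + 1, C.add_mem hc hone, ?_⟩⟩
    · have := hle c; omega
    · omega
  have hnm : n = x ∨ n = y ∨ n = z := by
    refine (hmem n).1 ⟨hn, 1, hone, ?_⟩
    have h2 := hcompl 0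
    have h0 : wt (0 : Fin n → ZMod 2) = 0 := by rw [wt_eq_card]; simp
    rw [zero_add, h0] at h2
    omega
  have hw : ∃ w, 2 * w ≠ n ∧ w ≤ n ∧ ∀ i, (i = x ∨ i = y ∨ i = z) → i = n ∨ i = w ∨ i + w = n := by
    have hx := hcl x (by simp)
    have hy := hcl y (by simp)
    have hz := hcl z (by simp)
    rcases hnm with h | h | h
    · exact ⟨y, by omega, by omega, fun i hi => by omega⟩
    · exact ⟨x, by omega, by omega, fun i hi => by omega⟩
    · exact ⟨x, by omega, by omega, fun i hi => by omega⟩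
  obtain ⟨w, hw1, hw2, hw3⟩ := hw
  refine ⟨(n : ℚ) - 2 * w, ?_, ?_⟩
  · intro h
    apply hw1
    have : (2 * (w : ℚ)) = n := by linarith
    exact_mod_cast this
  · intro c hc
    by_cases h0 : wt c = 0
    · exact Or.inl (hzero c h0)
    · rcases hw3 _ ((hmem (wt c)).1 ⟨by omega, c, hc, rfl⟩) with h | h | h
      · exact Or.inr (Or.inl (hfull c h))
      · right; right; left; rw [ssum_eq, h]
      · right; right; right; rw [ssum_eq]
        have : (wt c : ℚ) + w = n := by exact_mod_cast h
        linarith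

open Classical in
theorem phi_decomp {n : ℕ} (hn : 1 ≤ n) (C : Submodule (ZMod 2) (Fin n → ZMod 2))
    (s : ℚ) (hs : s ≠ 0) (h1 : (1 : Fin n → ZMod 2) ∈ C)
    (hC : ∀ c ∈ C, c = 0 ∨ c = 1 ∨ ssum c = s ∨ ssum c = -s) (φ : ℚ → ℚ) :
    ∃ a b e f : ℚ, ∀ g : (Fin n → ZMod 2) → ℚ,
      ∑ c : C, φ (ssum c.1) * g c = a * ∑ c : C, g c + b * ∑ c : C, ssum c.1 * g c
        + e * g 0 + f * g 1 := by
  have h01 : (0 : Fin n → ZMod 2) ≠ 1 := by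
    intro h
    have := congrFun h ⟨0, hn⟩
    simp at this
  have hs0 : ssum (0 : Fin n → ZMod 2) = n := by simp [ssum, sgn_zero]
  have hs1 : ssum (1 : Fin n → ZMod 2) = -n := by simp [ssum, sgn_one]
  obtain ⟨a, ha⟩ : ∃ a, a = (φ s + φ (-s)) / 2 := ⟨_, rfl⟩
  obtain ⟨b, hb⟩ : ∃ b, b = (φ s - φ (-s)) / (2 * s) := ⟨_, rfl⟩
  have hbs : b * s = (φ s - φ (-s)) / 2 := by rw [hb]; field_simp
  refine ⟨a, b, φ n - a - b * n, φ (-n) - a + b * n, fun g => ?_⟩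
  have key : ∀ c : C, φ (ssum c.1) * g c = a * g c + b * (ssum c.1 * g c)
      + (if c = (⟨0, C.zero_mem⟩ : C) then (φ n - a - b * n) * g 0 else 0)
      + (if c = (⟨1, h1⟩ : C) then (φ (-n) - a + b * n) * g 1 else 0) := by
    rintro ⟨c, hc⟩
    simp only [Subtype.mk.injEq]
    by_cases hc0 : c = 0
    · subst hc0
      rw [if_pos rfl, if_neg h01, hs0]; ring
    by_cases hc1 : c = 1
    · subst hc1
      rw [if_pos rfl, if_neg h01.symm, hs1]; ring
    rw [if_neg hc0, if_neg hc1]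
    rcases ((hC c hc).resolve_left hc0).resolve_left hc1 with h | h
    · rw [h]
      linear_combination (-g c) * ha + (-g c) * hbs
    · rw [h]
      linear_combination (-g c) * ha + (g c) * hbs
  rw [Finset.sum_congr rfl (fun c _ => key c)]
  simp only [Finset.sum_add_distrib, ← Finset.mul_sum, Finset.sum_ite_eq', Finset.mem_univ, if_true]

open Classical in
theorem char_sums {n : ℕ} (hn : 1 ≤ n) (C : Submodule (ZMod 2) (Fin n → ZMod 2))
    (s : ℚ) (hs : s ≠ 0) (h1 : (1 : Fin n → ZMod 2) ∈ C)
    (hproj : IsProjective (C : Set (Fin n → ZMod 2)))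
    (hC : ∀ c ∈ C, c = 0 ∨ c = 1 ∨ ssum c = s ∨ ssum c = -s) (φ : ℚ → ℚ) :
    (∃ T, ∀ p, ∑ c : C, φ (ssum c.1) * sgn (c.1 p) = T) ∧
    (∃ T, ∀ p q, p ≠ q → ∑ c : C, φ (ssum c.1) * (sgn (c.1 p) * sgn (c.1 q)) = T) := by
  obtain ⟨a, b, e, f, h⟩ := phi_decomp hn C s hs h1 hC φ
  have hodd : ∀ u : Fin n → ZMod 2, ip u 1 = 1 → ∑ c : C, sgn (ip u c) = 0 := by
    intro u hu
    apply orth_zero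
    rw [mem_dual]
    intro h'
    rw [h' 1 h1] at hu
    exact absurd hu (by decide)
  have hpp : ∀ p, ∑ c : C, sgn (c.1 p) = 0 := by
    intro p
    have := hodd (Pi.single p 1) (by rw [ip_single]; rfl)
    simpa only [ip_single] using this
  have hpq : ∀ p q, p ≠ q → ∑ c : C, sgn (c.1 p) * sgn (c.1 q) = 0 := by
    intro p q hpq
    have hs2 : ssum (0 + Pi.single p 1 + Pi.single q 1 : Fin n → ZMod 2) = n - 4 := by
      rw [ssum_add_single, ssum_add_single]
      have : ssum (0 : Fin n → ZMod 2) = n := by simp [ssum, sgn_zero]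
      rw [this]
      simp [hpq.symm, sgn_zero]
      ring
    rw [zero_add, ssum_eq] at hs2
    have hw : wt (Pi.single p 1 + Pi.single q 1 : Fin n → ZMod 2) = 2 := by
      have : (wt (Pi.single p 1 + Pi.single q 1 : Fin n → ZMod 2) : ℚ) = 2 := by linarith
      exact_mod_cast this
    have := orth_zero C (Pi.single p 1 + Pi.single q 1) (fun hd => by
      have h3 := hproj _ hd (fun h0 => by
        have := congrFun h0 p
        simp [hpq] at this)
      omega)
    simpa only [ip_add_left, ip_single, sgn_add] using this
  have hppq : ∀ i p q, ∑ c : C, sgn (c.1 i) * (sgn (c.1 p) * sgn (c.1 q)) = 0 := by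
    intro i p q
    have := hodd (Pi.single i 1 + (Pi.single p 1 + Pi.single q 1))
      (by simp only [ip_add_left, ip_single, Pi.one_apply]; decide)
    simpa only [ip_add_left, ip_single, sgn_add] using this
  constructor
  · refine ⟨b * Fintype.card C + e - f, fun p => ?_⟩
    rw [h (fun c => sgn (c p)), hpp]
    have h2 : ∑ c : C, ssum c.1 * sgn (c.1 p) = Fintype.card C := by
      unfold ssum
      simp_rw [Finset.sum_mul]
      rw [Finset.sum_comm, Finset.sum_eq_single p]
      · have : ∀ c : C, sgn (c.1 p) * sgn (c.1 p) = 1 := by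
          intro c
          rcases zmod2_cases (c.1 p) with h | h <;> simp [h, sgn_zero, sgn_one]
        simp [this]
      · intro q _ hq
        exact hpq q p hq
      · simp
    rw [h2]
    simp [sgn_zero, sgn_one]
    ring
  · refine ⟨e + f, fun p q hne => ?_⟩
    rw [h (fun c => sgn (c p) * sgn (c q)), hpq p q hne]
    have h2 : ∑ c : C, ssum c.1 * (sgn (c.1 p) * sgn (c.1 q)) = 0 := by
      unfold ssum
      simp_rw [Finset.sum_mul]
      rw [Finset.sum_comm]
      exact Finset.sum_eq_zero fun i _ => hppq i p q
    rw [h2]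
    simp [sgn_zero, sgn_one]

open Classical in
theorem kraw_sums {n : ℕ} (hn : 1 ≤ n) (C : Submodule (ZMod 2) (Fin n → ZMod 2))
    (s : ℚ) (hs : s ≠ 0) (h1 : (1 : Fin n → ZMod 2) ∈ C)
    (hproj : IsProjective (C : Set (Fin n → ZMod 2)))
    (hC : ∀ c ∈ C, c = 0 ∨ c = 1 ∨ ssum c = s ∨ ssum c = -s) (m : ℕ) :
    (∃ T, ∀ p, ∑ c : C, kraw m (c.1 + Pi.single p 1) = T) ∧
    (∃ T, ∀ p q, p ≠ q → ∑ c : C, kraw m (c.1 + (Pi.single p 1 + Pi.single q 1)) = T) := by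
  obtain ⟨φ, hφ⟩ := kraw_factor n m
  constructor
  · obtain ⟨T, hT⟩ := (char_sums hn C s hs h1 hproj hC
      (fun t => (φ (t - 2) - φ (t + 2)) / 2)).1
    refine ⟨∑ c : C, (φ (ssum c.1 - 2) + φ (ssum c.1 + 2)) / 2 + T, fun p => ?_⟩
    rw [← hT p, ← Finset.sum_add_distrib]
    refine Finset.sum_congr rfl fun c _ => ?_
    rw [hφ, ssum_add_single]
    rcases zmod2_cases (c.1 p) with h | h <;> simp only [h, sgn_zero, sgn_one]
    · rw [mul_one]; ring
    · rw [show ssum c.1 - 2 * -1 = ssum c.1 + 2 by ring]; ring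
  · obtain ⟨T1, hT1⟩ := (char_sums hn C s hs h1 hproj hC
      (fun t => (φ (t - 4) - φ (t + 4)) / 4)).1
    obtain ⟨T2, hT2⟩ := (char_sums hn C s hs h1 hproj hC
      (fun t => (φ (t - 4) - 2 * φ t + φ (t + 4)) / 4)).2
    refine ⟨∑ c : C, (φ (ssum c.1 - 4) + 2 * φ (ssum c.1) + φ (ssum c.1 + 4)) / 4 + T1 + T1 + T2,
      fun p q hpq => ?_⟩
    rw [← hT2 p q hpq]
    nth_rewrite 1 [← hT1 p]
    rw [← hT1 q, ← Finset.sum_add_distrib, ← Finset.sum_add_distrib, ← Finset.sum_add_distrib]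
    refine Finset.sum_congr rfl fun c _ => ?_
    rw [hφ, ← add_assoc, ssum_add_single, ssum_add_single]
    have hq : (c.1 + Pi.single p 1 : Fin n → ZMod 2) q = c.1 q := by simp [hpq.symm]
    rw [hq]
    rcases zmod2_cases (c.1 p) with h | h <;> rcases zmod2_cases (c.1 q) with h' | h' <;>
      simp only [h, h', sgn_zero, sgn_one]
    · rw [show ssum c.1 - 2 * 1 - 2 * 1 = ssum c.1 - 4 by ring]; ring
    · rw [show ssum c.1 - 2 * 1 - 2 * -1 = ssum c.1 by ring]; ring
    · rw [show ssum c.1 - 2 * -1 - 2 * 1 = ssum c.1 by ring]; ring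
    · rw [show ssum c.1 - 2 * -1 - 2 * -1 = ssum c.1 + 4 by ring]; ring

open Classical in
theorem exists_lam {n : ℕ} (hn : 1 ≤ n) (C : Submodule (ZMod 2) (Fin n → ZMod 2))
    (s : ℚ) (hs : s ≠ 0) (h1 : (1 : Fin n → ZMod 2) ∈ C)
    (hproj : IsProjective (C : Set (Fin n → ZMod 2)))
    (hC : ∀ c ∈ C, c = 0 ∨ c = 1 ∨ ssum c = s ∨ ssum c = -s) (m : ℕ) :
    ∃ T : ℚ, ∀ p q : Fin n, p ≠ q → (Nat.card {c : Fin n → ZMod 2 //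
      c ∈ dualCode (C : Set (Fin n → ZMod 2)) ∧ wt c = m ∧ c p ≠ 0 ∧ c q ≠ 0} : ℚ) = T := by
  obtain ⟨⟨T1, hT1⟩, ⟨T2, hT2⟩⟩ := kraw_sums hn C s hs h1 hproj hC m
  obtain ⟨T0, hT0⟩ : ∃ T0, T0 = ∑ c : C, kraw m (c.1 + 0) := ⟨_, rfl⟩
  have hcard : (Fintype.card C : ℚ) ≠ 0 := by
    have : Fintype.card C ≠ 0 := Fintype.card_ne_zero
    exact_mod_cast this
  refine ⟨(T0 - T1 - T1 + T2) / (4 * Fintype.card C), fun p q hpq => ?_⟩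
  rw [eq_div_iff (by simpa using hcard), ← hT2 p q hpq]
  nth_rewrite 1 [← hT1 p]
  rw [← hT1 q, hT0, ← poisson, ← poisson, ← poisson, ← poisson, Nat.card_eq_fintype_card,
    Fintype.card_subtype, ← Finset.sum_boole, ← mul_sub, ← mul_sub, ← mul_add, mul_comm (4 : ℚ),
    mul_comm, mul_assoc, Finset.mul_sum, ← Finset.sum_sub_distrib, ← Finset.sum_sub_distrib,
    ← Finset.sum_add_distrib]
  congr 1
  refine Finset.sum_congr rfl fun x _ => ?_
  have e0 : ip x 0 = 0 := by simp [ip]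
  have ep : ∀ p, ip x (Pi.single p 1) = x p := fun p => by rw [ip_comm, ip_single]
  simp only [ip_add_right, ep, e0, sgn_add]
  by_cases hx : x ∈ dualCode (C : Set (Fin n → ZMod 2)) ∧ wt x = m
  · simp only [hx.1, hx.2, true_and, and_self, if_true]
    rcases zmod2_cases (x p) with h | h <;> rcases zmod2_cases (x q) with h' | h' <;>
      simp [h, h', sgn_zero, sgn_one]
    norm_num
  · rw [if_neg (fun h => hx ⟨h.1, h.2.1⟩)]
    simp [hx]

open Classical in
theorem double_count {n : ℕ} (D : Set (Fin n → ZMod 2)) (m lam : ℕ)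
    (h : HoldsTwoDesign D m lam) : lam * (n * (n - 1)) = m * (m - 1) * weightCount D m := by
  have e1 : ∑ pq ∈ (Finset.univ : Finset (Fin n)).offDiag,
      (Finset.univ.filter (fun c : Fin n → ZMod 2 => c ∈ D ∧ wt c = m ∧ c pq.1 ≠ 0 ∧ c pq.2 ≠ 0)).card
      = lam * (n * (n - 1)) := by
    rw [Finset.sum_congr rfl (g := fun _ => lam)]
    · rw [Finset.sum_const, Finset.offDiag_card, smul_eq_mul, mul_comm, Finset.card_univ,
        Fintype.card_fin, Nat.mul_sub_one]
    · intro pq hpq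
      rw [Finset.mem_offDiag] at hpq
      rw [← h pq.1 pq.2 hpq.2.2, Nat.card_eq_fintype_card, Fintype.card_subtype]
  rw [← e1]
  simp_rw [Finset.card_filter]
  rw [Finset.sum_comm]
  unfold weightCount
  rw [Nat.card_eq_fintype_card, Fintype.card_subtype, Finset.card_filter, Finset.mul_sum]
  refine Finset.sum_congr rfl fun c _ => ?_
  by_cases hc : c ∈ D ∧ wt c = m
  · have hw := hc.2
    rw [wt_eq_card] at hw
    simp only [hc.1, hc.2, true_and, and_self, if_true]
    rw [← Finset.card_filter, mul_one, Nat.mul_sub_one]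
    have : (Finset.univ : Finset (Fin n)).offDiag.filter (fun pq => c pq.1 ≠ 0 ∧ c pq.2 ≠ 0)
        = (Finset.univ.filter (fun i => c i ≠ 0)).offDiag := by
      ext pq
      simp [Finset.mem_offDiag]
      tauto
    rw [this, Finset.offDiag_card, hw]
  · rw [if_neg hc, mul_zero]
    exact Finset.sum_eq_zero fun pq _ => if_neg (fun h' => hc ⟨h'.1, h'.2.1⟩)

theorem dual_designs_from_projective_three_weight (n k d : ℕ) (C : Submodule (ZMod 2) (Fin n → ZMod 2))
    (hk : Module.finrank (ZMod 2) C = k)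
    (hd : IsMinDist (C : Set (Fin n → ZMod 2)) d)
    (hproj : IsProjective (C : Set (Fin n → ZMod 2)))
    (h3 : numNonzeroWeights (C : Set (Fin n → ZMod 2)) = 3)
    (hAn : weightCount (C : Set (Fin n → ZMod 2)) n = 1) :
    ∀ r : ℕ, 2 ≤ r → r ≤ n / 2 - 1 →
      weightCount (dualCode (C : Set (Fin n → ZMod 2))) (2 * r) ≠ 0 →
      ∃ lam : ℕ,
        HoldsTwoDesign (dualCode (C : Set (Fin n → ZMod 2))) (2 * r) lam ∧
        lam * (n * (n - 1)) =
          2 * r * (2 * r - 1) * weightCount (dualCode (C : Set (Fin n → ZMod 2))) (2 * r) := by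
  intro r hr hrn _
  have hn : 2 ≤ n := by omega
  obtain ⟨h1, s, hs, hC⟩ := weights_structure (by omega) C h3 hAn
  obtain ⟨T, hT⟩ := exists_lam (by omega) C s hs h1 hproj hC (2 * r)
  have key : HoldsTwoDesign (dualCode (C : Set (Fin n → ZMod 2))) (2 * r)
      (Nat.card {c : Fin n → ZMod 2 // c ∈ dualCode (C : Set (Fin n → ZMod 2)) ∧ wt c = 2 * r ∧
        c ⟨0, by omega⟩ ≠ 0 ∧ c ⟨1, by omega⟩ ≠ 0}) := by
    intro p q hpq
    have e1 := hT p q hpq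
    rw [← hT ⟨0, by omega⟩ ⟨1, by omega⟩ (by simp)] at e1
    exact_mod_cast e1
  exact ⟨_, key, double_count _ _ _ key⟩
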